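/- For the Berwald–Moór metric of momenta the angular metrical d-tensor satisfies h^{ij} = a^i a^j for i ≠ j and h^{ii} = −(n−1)·(a^i)², the tensor U^{hijk} = ∑_r (a_r^{ij}a^{rhk} − a_r^{ik}a^{rhj}) satisfies U^{hijk} = −(n²/((n−1)²(n−2)²))·(h^{hj}h^{ik} − h^{hk}h^{ij}) for all indices h, i, j, k, and consequently the space is S3-like with scalar S = −1: K²·S^{hijk} = −(h^{hj}h^{ik} − h^{hk}h^{ij}) for all indices h, i, j, k. -/

import Mathlib

open Finset

noncomputable section

/-- The Berwald–Moór coefficients: `a^{i₁…i_n} = 1/n!` if the indices are pairwise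
distinct and `0` otherwise, with `n = N + 4`. -/
def BMc (N : ℕ) : (Fin (N + 4) → Fin (N + 4)) → ℝ :=
  fun ι => if Function.Injective ι then ((N + 4).factorial : ℝ)⁻¹ else 0

/-- `A(p) = ∑ a^{i₁…i_n} p_{i₁}⋯p_{i_n}`. -/
def Afun (N : ℕ) (p : Fin (N + 4) → ℝ) : ℝ :=
  ∑ ι : Fin (N + 4) → Fin (N + 4), BMc N ι * ∏ t, p (ι t)

/-- `K(p) = A(p)^{1/n}`, the Berwald–Moór metric of momenta. -/
def Kfun (N : ℕ) (p : Fin (N + 4) → ℝ) : ℝ :=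
  Afun N p ^ ((1 : ℝ) / (N + 4))

/-- `a^i = (∑ a^{i i₂…i_n} p_{i₂}⋯p_{i_n}) / K^{n-1}`. -/
def aU1 (N : ℕ) (i : Fin (N + 4)) (p : Fin (N + 4) → ℝ) : ℝ :=
  (∑ ι : Fin (N + 3) → Fin (N + 4), BMc N (Fin.cons i ι) * ∏ t, p (ι t)) / Kfun N p ^ (N + 3)

/-- `a^{ij} = (∑ a^{i j i₃…i_n} p_{i₃}⋯p_{i_n}) / K^{n-2}`. -/
def aU2 (N : ℕ) (i j : Fin (N + 4)) (p : Fin (N + 4) → ℝ) : ℝ :=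
  (∑ ι : Fin (N + 2) → Fin (N + 4), BMc N (Fin.cons i (Fin.cons j ι)) * ∏ t, p (ι t)) /
    Kfun N p ^ (N + 2)

/-- `a^{ijk} = (∑ a^{i j k i₄…i_n} p_{i₄}⋯p_{i_n}) / K^{n-3}`. -/
def aU3 (N : ℕ) (i j k : Fin (N + 4)) (p : Fin (N + 4) → ℝ) : ℝ :=
  (∑ ι : Fin (N + 1) → Fin (N + 4), BMc N (Fin.cons i (Fin.cons j (Fin.cons k ι))) *
    ∏ t, p (ι t)) / Kfun N p ^ (N + 1)

/-- The matrix `a_{ij}`: `a_{ij} = n a_i a_j` for `i ≠ j` and `a_{ii} = -n(n-2) a_i²`,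
where `a_i = p_i/K`. -/
def aLowBM (N : ℕ) (p : Fin (N + 4) → ℝ) (i j : Fin (N + 4)) : ℝ :=
  if i = j then -((N + 4 : ℝ) * (N + 2)) * (p i / Kfun N p) ^ 2
  else (N + 4 : ℝ) * (p i / Kfun N p) * (p j / Kfun N p)

/-- `g_{ij} = (1/(n-1)) a_{ij} + ((n-2)/(n-1)) a_i a_j`. -/
def gLowBM (N : ℕ) (p : Fin (N + 4) → ℝ) (i j : Fin (N + 4)) : ℝ :=
  (1 / (N + 3 : ℝ)) * aLowBM N p i j +
    ((N + 2 : ℝ) / (N + 3)) * (p i / Kfun N p) * (p j / Kfun N p)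

/-- Partial derivative `∂f/∂p_k` of a function of `p`. -/
def pd {n : ℕ} (f : (Fin n → ℝ) → ℝ) (k : Fin n) (p : Fin n → ℝ) : ℝ :=
  deriv (fun t => f (Function.update p k t)) (p k)

/-- Fundamental metrical d-tensor `g^{ij} = (1/2) ∂²(K²)/∂p_i∂p_j`. -/
def gU (N : ℕ) (i j : Fin (N + 4)) (p : Fin (N + 4) → ℝ) : ℝ :=
  (1 / 2 : ℝ) * pd (fun q => pd (fun r => Kfun N r ^ 2) j q) i p

/-- Angular metrical d-tensor `h^{ij} = K ∂²K/∂p_i∂p_j`. -/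
def hU (N : ℕ) (i j : Fin (N + 4)) (p : Fin (N + 4) → ℝ) : ℝ :=
  Kfun N p * pd (fun q => pd (Kfun N) j q) i p

/-- v-torsion d-tensor `C^{ijk} = -(1/2) ∂g^{ij}/∂p_k`. -/
def CU (N : ℕ) (i j k : Fin (N + 4)) (p : Fin (N + 4) → ℝ) : ℝ :=
  -(1 / 2 : ℝ) * pd (gU N i j) k p

/-- v-derivation components `C_i^{jk} = ∑_s g_{is} C^{sjk}`. -/
def CL (N : ℕ) (p : Fin (N + 4) → ℝ) (i j k : Fin (N + 4)) : ℝ :=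
  ∑ s, gLowBM N p i s * CU N s j k p

/-- Kronecker delta. -/
def dl {n : ℕ} (i j : Fin n) : ℝ := if i = j then 1 else 0

lemma bm_count (n m : ℕ) (S : Finset (Fin n)) :
    (∑ ι : Fin m → Fin n, if Function.Injective ι ∧ ∀ t, ι t ∉ S then (1 : ℝ) else 0) =
      ((n - S.card).descFactorial m : ℝ) := by
  classical
  rw [Finset.sum_boole]
  congr 1
  have h1 : Fintype.card (Fin m ↪ {x : Fin n // x ∉ S}) = (n - S.card).descFactorial m := by
    rw [Fintype.card_embedding_eq]
    simp [Fintype.card_subtype_compl]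
  rw [← h1, ← Finset.card_univ]
  symm
  refine Finset.card_bij (fun e _ t => (e t : Fin n)) ?_ ?_ ?_
  · intro e _
    simp only [Finset.mem_filter, Finset.mem_univ, true_and]
    exact ⟨fun a b hab => e.injective (Subtype.ext hab), fun t => (e t).2⟩
  · intro e _ f _ hef
    ext t
    exact congrArg Fin.val (congrFun hef t)
  · intro ι hι
    simp only [Finset.mem_filter, Finset.mem_univ, true_and] at hι
    refine ⟨⟨fun t => ⟨ι t, hι.2 t⟩, ?_⟩, Finset.mem_univ _, rfl⟩
    intro a b hab
    exact hι.1 (congrArg Subtype.val hab)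

lemma bm_prod (N : ℕ) (p : Fin (N + 4) → ℝ) (ι : Fin (N + 4) → Fin (N + 4))
    (h : Function.Injective ι) : ∏ t, p (ι t) = ∏ t, p t :=
  Fintype.prod_bijective ι (Finite.injective_iff_bijective.mp h) _ _ (fun _ => rfl)

lemma Afun_eq (N : ℕ) (p : Fin (N + 4) → ℝ) : Afun N p = ∏ t, p t := by
  have h := bm_count (N + 4) (N + 4) ∅
  have hf : ((N + 4).factorial : ℝ) ≠ 0 := by positivity
  have : Afun N p = (∑ ι : Fin (N + 4) → Fin (N + 4),
      if Function.Injective ι ∧ ∀ t, ι t ∉ (∅ : Finset (Fin (N + 4))) then (1 : ℝ) else 0) *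
      (((N + 4).factorial : ℝ)⁻¹ * ∏ t, p t) := by
    rw [Finset.sum_mul]
    refine Finset.sum_congr rfl fun ι _ => ?_
    by_cases hi : Function.Injective ι
    · simp [BMc, hi, bm_prod N p ι hi]
    · simp [BMc, hi]
  rw [this, h]
  simp only [Finset.card_empty, Nat.sub_zero, Nat.descFactorial_self]
  field_simp

lemma Kpos (N : ℕ) (p : Fin (N + 4) → ℝ) (hp : ∀ i, 0 < p i) : 0 < Kfun N p := by
  unfold Kfun
  rw [Afun_eq]
  exact Real.rpow_pos_of_pos (Finset.prod_pos fun i _ => hp i) _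

lemma Kpow (N : ℕ) (p : Fin (N + 4) → ℝ) (hp : ∀ i, 0 < p i) :
    Kfun N p ^ (N + 4) = ∏ t, p t := by
  unfold Kfun
  rw [Afun_eq, ← Real.rpow_natCast, ← Real.rpow_mul (Finset.prod_pos fun i _ => hp i).le]
  push_cast
  rw [one_div, inv_mul_cancel₀ (by positivity), Real.rpow_one]

lemma aU1_eq (N : ℕ) (p : Fin (N + 4) → ℝ) (hp : ∀ i, 0 < p i) (i : Fin (N + 4)) :
    aU1 N i p = Kfun N p / ((N + 4) * p i) := by
  have h := bm_count (N + 4) (N + 3) {i}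
  have hK := Kpos N p hp
  have hpi := hp i
  have hf : ((N + 3).factorial : ℝ) ≠ 0 := by positivity
  have : (∑ ι : Fin (N + 3) → Fin (N + 4), BMc N (Fin.cons i ι) * ∏ t, p (ι t)) =
      (∑ ι : Fin (N + 3) → Fin (N + 4),
      if Function.Injective ι ∧ ∀ t, ι t ∉ ({i} : Finset (Fin (N + 4))) then (1 : ℝ) else 0) *
      (((N + 4).factorial : ℝ)⁻¹ * (Kfun N p ^ (N + 4) / p i)) := by
    rw [Finset.sum_mul, Kpow N p hp]
    refine Finset.sum_congr rfl fun ι _ => ?_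
    have he : Function.Injective (Fin.cons i ι : Fin (N + 4) → Fin (N + 4)) ↔
        (Function.Injective ι ∧ ∀ t, ι t ∉ ({i} : Finset (Fin (N + 4)))) := by
      rw [Fin.cons_injective_iff]
      simp [and_comm]
    by_cases hi : Function.Injective (Fin.cons i ι : Fin (N + 4) → Fin (N + 4))
    · rw [if_pos (he.mp hi)]
      have := bm_prod N p _ hi
      rw [Fin.prod_univ_succ] at this
      simp only [Fin.cons_zero, Fin.cons_succ] at this
      rw [← this]
      simp only [BMc, if_pos hi]
      field_simp
    · rw [if_neg (fun hh => hi (he.mpr hh))]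
      simp [BMc, hi]
  unfold aU1
  rw [this, h]
  simp only [Finset.card_singleton, show N + 4 - 1 = N + 3 from rfl, Nat.descFactorial_self]
  rw [show (N + 4).factorial = (N + 4) * (N + 3).factorial from Nat.factorial_succ _]
  push_cast
  field_simp
  ring

lemma aU3_eq (N : ℕ) (p : Fin (N + 4) → ℝ) (hp : ∀ i, 0 < p i) (i j k : Fin (N + 4)) :
    aU3 N i j k p = Kfun N p ^ 3 / ((N + 4) * (N + 3) * (N + 2) * (p i * p j * p k)) *
      ((1 - dl j k) * (1 - dl i j - dl i k)) := by
  have hK := Kpos N p hp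
  have hpi := hp i
  have hpj := hp j
  have hpk := hp k
  by_cases hd : i ≠ j ∧ i ≠ k ∧ j ≠ k
  swap
  · have h0 : ((1 - dl j k) * (1 - dl i j - dl i k)) = 0 := by
      unfold dl
      by_cases h1 : i = j <;> by_cases h2 : i = k <;> by_cases h3 : j = k <;> simp_all
    rw [h0, mul_zero]
    unfold aU3
    rw [Finset.sum_eq_zero, zero_div]
    intro ι _
    rw [BMc, if_neg, zero_mul]
    rw [Fin.cons_injective_iff, Fin.cons_injective_iff]
    rintro ⟨h1, h2, _⟩
    apply hd
    refine ⟨?_, ?_, ?_⟩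
    · rintro rfl
      exact h1 ⟨0, rfl⟩
    · rintro rfl
      exact h1 ⟨1, rfl⟩
    · rintro rfl
      exact h2 ⟨0, rfl⟩
  obtain ⟨hij, hik, hjk⟩ := hd
  have h := bm_count (N + 4) (N + 1) {i, j, k}
  have hc : ({i, j, k} : Finset (Fin (N + 4))).card = 3 := Finset.card_eq_three.mpr
    ⟨i, j, k, hij, hik, hjk, rfl⟩
  have hf : ((N + 1).factorial : ℝ) ≠ 0 := by positivity
  have : (∑ ι : Fin (N + 1) → Fin (N + 4),
        BMc N (Fin.cons i (Fin.cons j (Fin.cons k ι))) * ∏ t, p (ι t)) =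
      (∑ ι : Fin (N + 1) → Fin (N + 4),
      if Function.Injective ι ∧ ∀ t, ι t ∉ ({i, j, k} : Finset (Fin (N + 4))) then (1 : ℝ) else 0) *
      (((N + 4).factorial : ℝ)⁻¹ * (Kfun N p ^ (N + 4) / (p i * p j * p k))) := by
    rw [Finset.sum_mul, Kpow N p hp]
    refine Finset.sum_congr rfl fun ι _ => ?_
    have he : Function.Injective
        (Fin.cons i (Fin.cons j (Fin.cons k ι)) : Fin (N + 4) → Fin (N + 4)) ↔
        (Function.Injective ι ∧ ∀ t, ι t ∉ ({i, j, k} : Finset (Fin (N + 4)))) := by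
      rw [Fin.cons_injective_iff, Fin.cons_injective_iff, Fin.cons_injective_iff]
      simp only [Set.mem_range, not_exists, Fin.forall_fin_succ (n := N + 2), Fin.cons_zero,
        Fin.cons_succ, Finset.mem_insert, Finset.mem_singleton, not_or]
      rw [Fin.forall_fin_succ (n := N + 1), Fin.forall_fin_succ (n := N + 1)]
      simp only [Fin.cons_zero, Fin.cons_succ, forall_and]
      have := hij.symm
      have := hik.symm
      have := hjk.symm
      tauto
    by_cases hi : Function.Injective
        (Fin.cons i (Fin.cons j (Fin.cons k ι)) : Fin (N + 4) → Fin (N + 4))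
    · rw [if_pos (he.mp hi)]
      have := bm_prod N p _ hi
      rw [Fin.prod_univ_succ, Fin.prod_univ_succ, Fin.prod_univ_succ] at this
      simp only [Fin.cons_zero, Fin.cons_succ] at this
      rw [← this]
      simp only [BMc, if_pos hi]
      field_simp
    · rw [if_neg (fun hh => hi (he.mpr hh))]
      simp [BMc, hi]
  unfold aU3
  rw [this, h, hc]
  simp only [show N + 4 - 3 = N + 1 from rfl, Nat.descFactorial_self]
  rw [show (N + 4).factorial = (N + 4) * ((N + 3) * ((N + 2) * (N + 1).factorial)) from by
    rw [Nat.factorial_succ, Nat.factorial_succ, Nat.factorial_succ]]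
  simp only [dl, if_neg hij, if_neg hik, if_neg hjk]
  push_cast
  field_simp
  ring

lemma upd_pos {n : ℕ} (p : Fin n → ℝ) (hp : ∀ i, 0 < p i) (k : Fin n) :
    ∀ᶠ t in nhds (p k), ∀ i, 0 < Function.update p k t i := by
  filter_upwards [lt_mem_nhds (hp k)] with t ht i
  by_cases h : i = k
  · subst h
    simpa using ht
  · simpa [Function.update_of_ne h] using hp i

lemma pd_congr {n : ℕ} (f g : (Fin n → ℝ) → ℝ) (hfg : ∀ q, (∀ i, 0 < q i) → f q = g q)
    (p : Fin n → ℝ) (hp : ∀ i, 0 < p i) (k : Fin n) : pd f k p = pd g k p := by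
  unfold pd
  apply Filter.EventuallyEq.deriv_eq
  filter_upwards [upd_pos p hp k] with t ht using hfg _ ht

lemma upd_deriv {n : ℕ} (p : Fin n → ℝ) (k i : Fin n) :
    HasDerivAt (fun t => Function.update p k t i) (dl k i) (p k) := by
  unfold dl
  by_cases h : k = i
  · subst h
    simpa using hasDerivAt_id' (p k)
  · simpa [Function.update_of_ne (Ne.symm h), h] using hasDerivAt_const (p k) (p i)

lemma K_deriv (N : ℕ) (p : Fin (N + 4) → ℝ) (hp : ∀ i, 0 < p i) (k : Fin (N + 4)) :
    HasDerivAt (fun t => Kfun N (Function.update p k t)) (Kfun N p / ((N + 4) * p k)) (p k) := by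
  have hpk := hp k
  have hP : 0 < ∏ t, p t := Finset.prod_pos fun i _ => hp i
  have h1 : HasDerivAt (fun t => ∏ x, Function.update p k t x) ((∏ x, p x) / p k) (p k) := by
    have e : (fun t => ∏ x, Function.update p k t x) =
        fun t => t * ∏ x ∈ Finset.univ \ {k}, p x := by
      funext t
      rw [Finset.prod_update_of_mem (Finset.mem_univ k)]
    have e2 : (∏ x, p x) / p k = ∏ x ∈ Finset.univ \ {k}, p x := by
      have := congrFun e (p k)
      simp only [Function.update_eq_self] at this
      rw [this]
      field_simp
    rw [e, e2]
    simpa using (hasDerivAt_id (p k)).mul_const (∏ x ∈ Finset.univ \ {k}, p x)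
  have h2 := h1.rpow_const (p := (1 : ℝ) / (N + 4)) (Or.inl (by simpa using hP.ne'))
  simp only [Function.update_eq_self] at h2
  unfold Kfun
  simp only [Afun_eq]
  convert h2 using 1
  rw [Real.rpow_sub_one hP.ne']
  field_simp

lemma pd_K (N : ℕ) (p : Fin (N + 4) → ℝ) (hp : ∀ i, 0 < p i) (k : Fin (N + 4)) :
    pd (Kfun N) k p = Kfun N p / ((N + 4) * p k) := (K_deriv N p hp k).deriv

lemma hU_eq (N : ℕ) (p : Fin (N + 4) → ℝ) (hp : ∀ i, 0 < p i) (i j : Fin (N + 4)) :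
    hU N i j p = Kfun N p ^ 2 / ((N + 4) ^ 2 * (p i * p j)) * (1 - (N + 4) * dl i j) := by
  unfold hU
  rw [pd_congr _ (fun q => Kfun N q / ((N + 4) * q j)) (fun q hq => pd_K N q hq j) p hp i]
  have hpi := hp i
  have hpj := hp j
  have h := (K_deriv N p hp i).div ((upd_deriv p i j).const_mul ((N : ℝ) + 4))
    (by simp only [Function.update_eq_self]; positivity)
  unfold pd
  erw [h.deriv]
  simp only [Function.update_eq_self]
  by_cases hij : i = j
  · subst hij
    simp only [dl, if_true]
    field_simp
  · simp only [dl, if_neg hij]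
    field_simp
    ring

lemma pd_K2 (N : ℕ) (p : Fin (N + 4) → ℝ) (hp : ∀ i, 0 < p i) (k : Fin (N + 4)) :
    pd (fun r => Kfun N r ^ 2) k p = 2 * Kfun N p ^ 2 / ((N + 4) * p k) := by
  have h := (K_deriv N p hp k).pow 2
  have hpk := hp k
  unfold pd
  erw [h.deriv]
  simp only [Function.update_eq_self]
  field_simp
  norm_num
  ring

lemma gU_eq (N : ℕ) (p : Fin (N + 4) → ℝ) (hp : ∀ i, 0 < p i) (i j : Fin (N + 4)) :
    gU N i j p = Kfun N p ^ 2 / (p i * p j) * (2 / (N + 4) ^ 2 - dl i j / (N + 4)) := by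
  unfold gU
  rw [pd_congr _ (fun q => 2 * Kfun N q ^ 2 / ((N + 4) * q j)) (fun q hq => pd_K2 N q hq j) p hp i]
  have hpi := hp i
  have hpj := hp j
  have h := (((K_deriv N p hp i).pow 2).const_mul 2).div
    ((upd_deriv p i j).const_mul ((N : ℝ) + 4))
    (by simp only [Function.update_eq_self]; positivity)
  unfold pd
  erw [h.deriv]
  simp only [Function.update_eq_self, Pi.pow_apply]
  by_cases hij : i = j
  · subst hij
    simp only [dl, if_true]
    field_simp
    ring
  · simp only [dl, if_neg hij]
    field_simp
    ring

/-- The constant part of the v-torsion. -/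
def gam (N : ℕ) (i j k : Fin (N + 4)) : ℝ :=
  2 / (N + 4) ^ 3 - (dl i j + dl i k + dl j k) / (N + 4) ^ 2 + dl i j * dl i k / (N + 4)

lemma CU_eq (N : ℕ) (p : Fin (N + 4) → ℝ) (hp : ∀ i, 0 < p i) (i j k : Fin (N + 4)) :
    CU N i j k p = -(Kfun N p ^ 2 / (p i * p j * p k)) * gam N i j k := by
  unfold CU
  rw [pd_congr _ (fun q => Kfun N q ^ 2 / (q i * q j) * (2 / (N + 4) ^ 2 - dl i j / (N + 4)))
    (fun q hq => gU_eq N q hq i j) p hp k]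
  have hpi := hp i
  have hpj := hp j
  have hpk := hp k
  have h := (((K_deriv N p hp k).pow 2).div
    ((upd_deriv p k i).mul (upd_deriv p k j))
    (by simp only [Pi.mul_apply, Function.update_eq_self]; positivity)).mul_const
      (2 / ((N : ℝ) + 4) ^ 2 - dl i j / (N + 4))
  unfold pd
  erw [h.deriv]
  simp only [Function.update_eq_self, Pi.pow_apply, Pi.mul_apply, gam]
  by_cases hij : i = j
  · subst hij
    by_cases hik : i = k
    · subst hik
      simp only [dl, if_true]
      field_simp
      ring
    · simp only [dl, if_true, if_neg hik, if_neg (Ne.symm hik)]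
      field_simp
      ring
  · by_cases hik : i = k
    · subst hik
      simp only [dl, if_true, if_neg hij, if_neg (Ne.symm hij)]
      field_simp
      ring
    · by_cases hjk : j = k
      · subst hjk
        simp only [dl, if_true, if_neg hij, if_neg (Ne.symm hij)]
        field_simp
        ring
      · simp only [dl, if_neg hij, if_neg hik, if_neg hjk, if_neg (Ne.symm hik),
          if_neg (Ne.symm hjk)]
        field_simp
        ring

lemma aLow_eq (N : ℕ) (p : Fin (N + 4) → ℝ) (i j : Fin (N + 4)) :
    aLowBM N p i j = p i * p j / Kfun N p ^ 2 * ((N + 4) * (1 - (N + 3) * dl i j)) := by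
  unfold aLowBM dl
  by_cases hij : i = j
  · subst hij
    simp only [if_true]
    ring
  · simp only [if_neg hij]
    ring

lemma gLow_eq (N : ℕ) (p : Fin (N + 4) → ℝ) (i j : Fin (N + 4)) :
    gLowBM N p i j = p i * p j / Kfun N p ^ 2 * (2 - (N + 4) * dl i j) := by
  unfold gLowBM
  rw [aLow_eq]
  have : (N : ℝ) + 3 ≠ 0 := by positivity
  field_simp
  ring

lemma dl_comm {n : ℕ} (i j : Fin n) : dl i j = dl j i := by
  simp [dl, eq_comm]

lemma sum_dl {n : ℕ} (i : Fin n) (f : Fin n → ℝ) : ∑ s, dl s i * f s = f i := by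
  simp [dl]

lemma sum_dl1 {n : ℕ} (i : Fin n) : ∑ s, dl s i = 1 := by
  simp [dl]

lemma sum_gam (N : ℕ) (i j : Fin (N + 4)) : ∑ s, gam N s i j = 0 := by
  have e : ∀ s, gam N s i j = (2 / (N + 4) ^ 3 - dl i j / (N + 4) ^ 2) -
      dl s i * (1 / (N + 4) ^ 2) - dl s j * (1 / (N + 4) ^ 2) + dl s i * (dl s j / (N + 4)) := by
    intro s
    unfold gam
    ring
  simp only [e, Finset.sum_add_distrib, Finset.sum_sub_distrib, sum_dl, Finset.sum_const,
    Finset.card_univ, Fintype.card_fin, nsmul_eq_mul]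
  push_cast
  field_simp
  ring

lemma CL_eq (N : ℕ) (p : Fin (N + 4) → ℝ) (hp : ∀ i, 0 < p i) (r i j : Fin (N + 4)) :
    CL N p r i j = p r / (p i * p j) * ((N + 4) * gam N r i j) := by
  unfold CL
  have hK := Kpos N p hp
  have hpi := hp i
  have hpj := hp j
  have e : ∀ s, gLowBM N p r s * CU N s i j p = (-2 * p r / (p i * p j)) * gam N s i j +
      dl s r * ((N + 4) * p r / (p i * p j) * gam N s i j) := by
    intro s
    have hps := hp s
    rw [gLow_eq, CU_eq N p hp, dl_comm r s]
    field_simp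
    ring
  simp only [e, Finset.sum_add_distrib, ← Finset.mul_sum, sum_gam, sum_dl]
  ring

lemma sum_gam2 (N : ℕ) (h i j k : Fin (N + 4)) : ∑ r, gam N r i j * gam N r h k =
    -(gam N i h k + gam N j h k) / (N + 4) ^ 2 + dl i j * gam N i h k / (N + 4) := by
  have e : ∀ s, gam N s i j * gam N s h k = (2 / (N + 4) ^ 3 - dl i j / (N + 4) ^ 2) * gam N s h k -
      dl s i * (1 / (N + 4) ^ 2 * gam N s h k) - dl s j * (1 / (N + 4) ^ 2 * gam N s h k)
      + dl s i * (dl s j / (N + 4) * gam N s h k) := by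
    intro s
    rw [gam]
    ring
  simp only [e, Finset.sum_add_distrib, Finset.sum_sub_distrib, sum_dl, ← Finset.mul_sum, sum_gam]
  ring

lemma dl_01 {n : ℕ} (i j : Fin n) : dl i j = 0 ∨ dl i j = 1 := by
  unfold dl
  by_cases h : i = j <;> simp [h]

lemma dl_tri1 {n : ℕ} (i j k : Fin n) : dl i j * dl i k = dl i j * dl j k := by
  by_cases h : i = j
  · rw [h]
  · simp [dl, h]

lemma dl_tri2 {n : ℕ} (i j k : Fin n) : dl i j * dl i k = dl i k * dl j k := by
  by_cases h : i = k
  · rw [h, dl_comm k j, mul_comm]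
  · simp [dl, h]

lemma dl_cases {n : ℕ} (h i j k : Fin n) (P : ℝ → ℝ → ℝ → ℝ → ℝ → ℝ → Prop)
    (H : ∀ a b c d e f : ℝ, (a = 0 ∨ a = 1) → (b = 0 ∨ b = 1) → (c = 0 ∨ c = 1) →
      (d = 0 ∨ d = 1) → (e = 0 ∨ e = 1) → (f = 0 ∨ f = 1) →
      a * b = a * d → a * b = b * d → a * c = a * e → a * c = c * e →
      b * c = b * f → b * c = c * f → d * e = d * f → d * e = e * f → P a b c d e f) :
    P (dl h i) (dl h j) (dl h k) (dl i j) (dl i k) (dl j k) := by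
  apply H
  all_goals first
    | exact dl_01 _ _
    | exact dl_tri1 _ _ _
    | exact dl_tri2 _ _ _

lemma S_alg (N : ℕ) (h i j k : Fin (N + 4)) :
    (N + 4 : ℝ) * ((∑ r, gam N r i j * gam N r h k) - ∑ r, gam N r i k * gam N r h j) =
      (1 / (N + 4) ^ 4) * ((1 - (N + 4) * dl h j) * (1 - (N + 4) * dl i k) -
        (1 - (N + 4) * dl h k) * (1 - (N + 4) * dl i j)) := by
  rw [sum_gam2, sum_gam2]
  unfold gam
  rw [dl_comm i h, dl_comm j h, dl_comm k h, dl_comm k j]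
  apply dl_cases h i j k (fun a b c d e f => (N + 4 : ℝ) *
    (-(2 / (N + 4) ^ 3 - (a + e + c) / (N + 4) ^ 2 + a * e / (N + 4) +
      (2 / (N + 4) ^ 3 - (b + f + c) / (N + 4) ^ 2 + b * f / (N + 4))) / (N + 4) ^ 2 +
      d * (2 / (N + 4) ^ 3 - (a + e + c) / (N + 4) ^ 2 + a * e / (N + 4)) / (N + 4) -
    (-(2 / (N + 4) ^ 3 - (a + d + b) / (N + 4) ^ 2 + a * d / (N + 4) +
      (2 / (N + 4) ^ 3 - (c + f + b) / (N + 4) ^ 2 + c * f / (N + 4))) / (N + 4) ^ 2 +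
      e * (2 / (N + 4) ^ 3 - (a + d + b) / (N + 4) ^ 2 + a * d / (N + 4)) / (N + 4))) =
    (1 / (N + 4) ^ 4) * ((1 - (N + 4) * b) * (1 - (N + 4) * e) -
        (1 - (N + 4) * c) * (1 - (N + 4) * d)))
  intro a b c d e f ha hb hc hd he hf h1 h2 h3 h4 h5 h6 h7 h8
  rcases ha with rfl | rfl <;> rcases hb with rfl | rfl <;> rcases hc with rfl | rfl <;>
  rcases hd with rfl | rfl <;> rcases he with rfl | rfl <;> rcases hf with rfl | rfl <;>
  first
  | (exfalso; linarith)
  | (field_simp; ring)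

lemma U_alg (N : ℕ) (h i j k : Fin (N + 4)) :
    (∑ r, (1 - dl i j) * ((N + 2) - (N + 3) * (1 - dl r i - dl r j)) *
        ((1 - dl h k) * (1 - dl r h - dl r k))) -
      (∑ r, (1 - dl i k) * ((N + 2) - (N + 3) * (1 - dl r i - dl r k)) *
        ((1 - dl h j) * (1 - dl r h - dl r j))) =
      -(1 / (N + 4 : ℝ)) * ((1 - (N + 4) * dl h j) * (1 - (N + 4) * dl i k) -
        (1 - (N + 4) * dl h k) * (1 - (N + 4) * dl i j)) := by
  have e : ∀ h i j k : Fin (N + 4), (∑ r, (1 - dl i j) * ((N + 2) - (N + 3) * (1 - dl r i - dl r j)) *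
        ((1 - dl h k) * (1 - dl r h - dl r k))) = (1 - dl i j) * (1 - dl h k) *
        (-(N + 2) + (N + 3) * (2 - dl i h - dl i k - dl j h - dl j k) : ℝ) := by
    intro h i j k
    have e : ∀ r, (1 - dl i j) * ((N + 2) - (N + 3) * (1 - dl r i - dl r j)) *
        ((1 - dl h k) * (1 - dl r h - dl r k)) = ((1 - dl i j) * (1 - dl h k)) *
        ((-1) + dl r h + dl r k + dl r i * ((N + 3) * (1 - dl r h - dl r k))
          + dl r j * ((N + 3) * (1 - dl r h - dl r k)) : ℝ) := by
      intro r
      ring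
    simp only [e, ← Finset.mul_sum, Finset.sum_add_distrib, sum_dl, sum_dl1, Finset.sum_const,
      Finset.card_univ, Fintype.card_fin, nsmul_eq_mul]
    push_cast
    ring
  rw [e, e, dl_comm i h, dl_comm j h, dl_comm k h, dl_comm k j]
  apply dl_cases h i j k (fun a b c d e f => (1 - d) * (1 - c) *
        (-(N + 2) + (N + 3) * (2 - a - e - b - f)) - (1 - e) * (1 - b) *
        (-(N + 2) + (N + 3) * (2 - a - d - c - f)) =
    -(1 / (N + 4 : ℝ)) * ((1 - (N + 4) * b) * (1 - (N + 4) * e) -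
        (1 - (N + 4) * c) * (1 - (N + 4) * d)))
  intro a b c d e f ha hb hc hd he hf h1 h2 h3 h4 h5 h6 h7 h8
  rcases ha with rfl | rfl <;> rcases hb with rfl | rfl <;> rcases hc with rfl | rfl <;>
  rcases hd with rfl | rfl <;> rcases he with rfl | rfl <;> rcases hf with rfl | rfl <;>
  first
  | (exfalso; linarith)
  | (field_simp; ring)

lemma aL_eq (N : ℕ) (p : Fin (N + 4) → ℝ) (hp : ∀ i, 0 < p i) (r i j : Fin (N + 4)) :
    ∑ s, aLowBM N p r s * aU3 N s i j p = p r * Kfun N p / ((N + 3) * (N + 2) * (p i * p j)) *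
      ((1 - dl i j) * ((N + 2) - (N + 3) * (1 - dl r i - dl r j))) := by
  have hK := Kpos N p hp
  have hpi := hp i
  have hpj := hp j
  have e : ∀ s, aLowBM N p r s * aU3 N s i j p =
      (p r * Kfun N p / ((N + 3) * (N + 2) * (p i * p j)) * (1 - dl i j)) *
      (1 - dl s i - dl s j - dl s r * ((N + 3) * (1 - dl s i - dl s j))) := by
    intro s
    have hps := hp s
    rw [aLow_eq, aU3_eq N p hp, dl_comm r s]
    field_simp
  simp only [e, ← Finset.mul_sum, Finset.sum_sub_distrib, sum_dl, sum_dl1, Finset.sum_const,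
      Finset.card_univ, Fintype.card_fin, nsmul_eq_mul]
  push_cast
  ring

/-- for the Berwald–Moór metric of momenta (`n = N + 4`):
`h^{ij} = a^i a^j` for `i ≠ j`, `h^{ii} = -(n-1)(a^i)²`,
`U^{hijk} = -(n²/((n-1)²(n-2)²))(h^{hj}h^{ik} - h^{hk}h^{ij})`, and the space is
S3-like with `S = -1`: `K² S^{hijk} = -(h^{hj}h^{ik} - h^{hk}h^{ij})`. -/
theorem stmt_18 (N : ℕ) (p : Fin (N + 4) → ℝ) (hp : ∀ i, 0 < p i) :
    (∀ i j, i ≠ j → hU N i j p = aU1 N i p * aU1 N j p) ∧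
    (∀ i, hU N i i p = -((N + 3 : ℝ)) * aU1 N i p ^ 2) ∧
    (∀ h i j k,
      (∑ r, ((∑ s, aLowBM N p r s * aU3 N s i j p) * aU3 N r h k p -
          (∑ s, aLowBM N p r s * aU3 N s i k p) * aU3 N r h j p)) =
        -((N + 4 : ℝ) ^ 2 / ((N + 3 : ℝ) ^ 2 * (N + 2 : ℝ) ^ 2)) *
          (hU N h j p * hU N i k p - hU N h k p * hU N i j p)) ∧
    (∀ h i j k,
      Kfun N p ^ 2 *
          (∑ r, (CL N p r i j * CU N r h k p - CL N p r i k * CU N r h j p)) =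
        -(hU N h j p * hU N i k p - hU N h k p * hU N i j p)) := by
  have hK := Kpos N p hp
  refine ⟨?_, ?_, ?_, ?_⟩
  · intro i j hij
    have hpi := hp i
    have hpj := hp j
    rw [hU_eq N p hp, aU1_eq N p hp, aU1_eq N p hp, dl, if_neg hij]
    field_simp
    ring
  · intro i
    have hpi := hp i
    rw [hU_eq N p hp, aU1_eq N p hp, dl, if_pos rfl]
    field_simp
    ring
  · intro h i j k
    have hph := hp h
    have hpi := hp i
    have hpj := hp j
    have hpk := hp k
    have e : ∀ h i j k : Fin (N + 4), ∀ r, (∑ s, aLowBM N p r s * aU3 N s i j p) * aU3 N r h k p =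
        (Kfun N p ^ 4 / ((N + 4) * (N + 3) ^ 2 * (N + 2) ^ 2 * (p h * p i * p j * p k))) *
        ((1 - dl i j) * ((N + 2) - (N + 3) * (1 - dl r i - dl r j)) *
        ((1 - dl h k) * (1 - dl r h - dl r k))) := by
      intro h i j k r
      have hph := hp h
      have hpi := hp i
      have hpj := hp j
      have hpk := hp k
      have hpr := hp r
      rw [aL_eq N p hp, aU3_eq N p hp]
      field_simp
    rw [Finset.sum_sub_distrib]
    simp only [e h i j k, e h i k j, ← Finset.mul_sum]
    rw [show p h * p i * p k * p j = p h * p i * p j * p k by ring, ← mul_sub, U_alg]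
    simp only [hU_eq N p hp]
    field_simp
  · intro h i j k
    have hph := hp h
    have hpi := hp i
    have hpj := hp j
    have hpk := hp k
    have e : ∀ h i j k : Fin (N + 4), ∀ r, CL N p r i j * CU N r h k p =
        (-(Kfun N p ^ 2 / (p h * p i * p j * p k)) * (N + 4)) *
        (gam N r i j * gam N r h k) := by
      intro h i j k r
      have hph := hp h
      have hpi := hp i
      have hpj := hp j
      have hpk := hp k
      have hpr := hp r
      rw [CL_eq N p hp, CU_eq N p hp]
      field_simp
    rw [Finset.sum_sub_distrib]
    simp only [e h i j k, e h i k j, ← Finset.mul_sum]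
    rw [show p h * p i * p k * p j = p h * p i * p j * p k by ring, ← mul_sub, mul_assoc _ ((N : ℝ) + 4), S_alg]
    simp only [hU_eq N p hp]
    field_simp
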